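/- arXiv:1511.05645 — 5 statements merged into one kernel-verified Lean document; each statement's English description precedes it below -/
import Mathlib

section
/- Let γ ∈ K^× be such that no archimedean absolute value of γ equals 1 and Σ_{v ∈ M_K^∞} λ_v(γ) > 0 (in particular γ is not a root of unity). Then there exists a constant c > 0 such that N(Φ_n(γ)) ≥ c·φ(n) for all sufficiently large n, where φ is Euler's totient function. -/
open NumberField

variable (K : Type*) [Field K] [NumberField K]

/-- `N(x) = (1/[K:ℚ]) log |N_{K/ℚ}(x)|` for `x ∈ K`. -/
noncomputable def Nval (x : K) : ℝ :=
  (Module.finrank ℚ K : ℝ)⁻¹ * Real.log |(Algebra.norm ℚ x : ℝ)|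

/-- `λ_v(γ) = (1/[K:ℚ]) log max(‖γ‖_v, 1)` for an infinite place `v`. -/
noncomputable def lamInf (w : InfinitePlace K) (γ : K) : ℝ :=
  (Module.finrank ℚ K : ℝ)⁻¹ * ((w.mult : ℝ) * Real.log (max (w γ) 1))

theorem aux_le_factorial (n B : ℕ) (h0 : n ≠ 0) (h : Nat.totient n ≤ B) :
    n ≤ (2 * B).factorial := by
  refine Nat.le_of_dvd (Nat.factorial_pos _) ?_
  rw [Nat.dvd_iff_prime_pow_dvd_dvd]
  intro p k hp hk
  rcases Nat.eq_zero_or_pos k with rfl | hk0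
  · simp
  have h1 : Nat.totient (p ^ k) ≤ B :=
    (Nat.le_of_dvd (Nat.totient_pos.2 (Nat.pos_of_ne_zero h0)) (Nat.totient_dvd_of_dvd hk)).trans h
  rw [Nat.totient_prime_pow hp hk0] at h1
  have h2 : p ^ k ≤ 2 * B := by
    obtain ⟨j, rfl⟩ : ∃ j, k = j + 1 := ⟨k - 1, by omega⟩
    obtain ⟨q, rfl⟩ : ∃ q, p = q + 2 := ⟨p - 2, by have := hp.two_le; omega⟩
    simp only [Nat.add_sub_cancel] at h1
    have h3 : q + 2 - 1 = q + 1 := by omega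
    rw [h3] at h1
    rw [pow_succ]
    nlinarith [Nat.zero_le ((q + 2) ^ j * q)]
  exact Nat.dvd_factorial (pow_pos hp.pos _) h2

theorem aux_log (u : ℂ) (r : ℝ) (hu : ‖u‖ ≤ r) (hr : r < 1) :
    |Real.log ‖u - 1‖| ≤ ‖u‖ / (1 - r) := by
  have h1 : 1 - ‖u‖ ≤ ‖u - 1‖ := by
    have := norm_sub_norm_le (1 : ℂ) u
    rw [norm_one, norm_sub_rev] at this; exact this
  have h2 : ‖u - 1‖ ≤ 1 + ‖u‖ := by
    have := norm_sub_le u (1 : ℂ)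
    rw [norm_one] at this; linarith
  have h0 := norm_nonneg u
  have hp : 0 < ‖u - 1‖ := by linarith
  have hr0 : 0 < 1 - r := by linarith
  rw [abs_le]
  constructor
  · have h3 := Real.one_sub_inv_le_log_of_pos hp
    have h4 : ‖u - 1‖⁻¹ ≤ (1 - ‖u‖)⁻¹ := inv_anti₀ (by linarith) h1
    have h5 : (1 - ‖u‖)⁻¹ = 1 + ‖u‖ / (1 - ‖u‖) := by
      have : 1 - ‖u‖ ≠ 0 := by linarith
      field_simp; ring
    have h6 : ‖u‖ / (1 - ‖u‖) ≤ ‖u‖ / (1 - r) := by gcongr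
    linarith
  · have h3 := Real.log_le_sub_one_of_pos hp
    have h6 : ‖u‖ ≤ ‖u‖ / (1 - r) := by
      rw [le_div_iff₀ hr0]; nlinarith
    linarith

theorem aux_h (z : ℂ) (hz0 : z ≠ 0) (hz : ‖z‖ ≠ 1) :
    ∃ r : ℝ, 0 ≤ r ∧ r < 1 ∧ ∀ n : ℕ, 0 < n → z ^ n - 1 ≠ 0 ∧
      |Real.log ‖z ^ n - 1‖ - n * Real.log (max ‖z‖ 1)| ≤ r ^ n / (1 - r) := by
  have hne : ∀ n : ℕ, 0 < n → z ^ n - 1 ≠ 0 := by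
    intro n hn h
    have h1 : ‖z‖ ^ n = 1 := by rw [← norm_pow, sub_eq_zero.1 h, norm_one]
    exact hz ((pow_eq_one_iff_of_nonneg (norm_nonneg _) hn.ne').1 h1)
  rcases lt_or_gt_of_ne hz with h | h
  · refine ⟨‖z‖, norm_nonneg _, h, fun n hn => ⟨hne n hn, ?_⟩⟩
    rw [max_eq_right h.le, Real.log_one, mul_zero, sub_zero, ← norm_pow]
    refine aux_log _ _ ?_ h
    rw [norm_pow]
    exact pow_le_of_le_one (norm_nonneg _) h.le hn.ne'
  · have hi : ‖z⁻¹‖ < 1 := by rw [norm_inv]; exact inv_lt_one_of_one_lt₀ h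
    refine ⟨‖z⁻¹‖, norm_nonneg _, hi, fun n hn => ⟨hne n hn, ?_⟩⟩
    rw [max_eq_left h.le]
    have e : z ^ n - 1 = -(z ^ n * ((z⁻¹) ^ n - 1)) := by
      rw [mul_sub, ← mul_pow, mul_inv_cancel₀ hz0]; simp
    have hne2 : (z⁻¹) ^ n - 1 ≠ 0 := by
      intro h0; apply hne n hn; rw [e, h0]; simp
    rw [e, norm_neg, norm_mul, Real.log_mul (by simp [hz0]) (by simpa using hne2), norm_pow,
      Real.log_pow, add_sub_cancel_left, ← norm_pow z⁻¹]
    refine aux_log _ _ ?_ hi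
    rw [norm_pow]
    exact pow_le_of_le_one (norm_nonneg _) hi.le hn.ne'

theorem aux_cyc (z : ℂ) (hz0 : z ≠ 0) (hz : ‖z‖ ≠ 1) :
    ∃ C : ℝ, ∀ n : ℕ, 0 < n → (Polynomial.cyclotomic n ℂ).eval z ≠ 0 ∧
      n.totient * Real.log (max ‖z‖ 1) - C ≤ Real.log ‖(Polynomial.cyclotomic n ℂ).eval z‖ := by
  obtain ⟨r, hr0, hr1, H⟩ := aux_h z hz0 hz
  have hprod : ∀ n : ℕ, 0 < n →
      ∏ i ∈ n.divisors, (Polynomial.cyclotomic i ℂ).eval z = z ^ n - 1 := by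
    intro n hn
    have := congrArg (Polynomial.eval z) (Polynomial.prod_cyclotomic_eq_X_pow_sub_one hn ℂ)
    simpa [Polynomial.eval_prod] using this
  have hne : ∀ n : ℕ, 0 < n → (Polynomial.cyclotomic n ℂ).eval z ≠ 0 := by
    intro n hn h0
    apply (H n hn).1
    rw [← hprod n hn]
    exact Finset.prod_eq_zero (Nat.mem_divisors_self n hn.ne') h0
  set L := Real.log (max ‖z‖ 1) with hL
  let f : ℕ → ℝ := fun n => Real.log ‖(Polynomial.cyclotomic n ℂ).eval z‖ - n.totient * L
  let g : ℕ → ℝ := fun n => Real.log ‖z ^ n - 1‖ - n * L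
  have hfg : ∀ n > 0, ∑ i ∈ n.divisors, f i = g n := by
    intro n hn
    simp only [f, g]
    rw [Finset.sum_sub_distrib, ← Finset.sum_mul, ← Nat.cast_sum, Nat.sum_totient, ← hprod n hn,
      norm_prod, Real.log_prod]
    intro i hi
    simpa using hne i (Nat.pos_of_mem_divisors hi)
  refine ⟨(1 - r)⁻¹ / (1 - r), fun n hn => ⟨hne n hn, ?_⟩⟩
  have hm := (ArithmeticFunction.sum_eq_iff_sum_mul_moebius_eq.1 hfg) n hn
  have hb : |f n| ≤ (1 - r)⁻¹ / (1 - r) := by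
    rw [← hm]
    calc _ ≤ ∑ x ∈ n.divisorsAntidiagonal, |(ArithmeticFunction.moebius x.1 : ℝ) * g x.2| :=
          Finset.abs_sum_le_sum_abs _ _
      _ ≤ ∑ x ∈ n.divisorsAntidiagonal, r ^ x.2 / (1 - r) := by
          refine Finset.sum_le_sum fun x hx => ?_
          rw [abs_mul]
          have h1 : |(ArithmeticFunction.moebius x.1 : ℝ)| ≤ 1 := by
            exact_mod_cast ArithmeticFunction.abs_moebius_le_one
          have hx2 : 0 < x.2 := by
            have := Nat.mem_divisorsAntidiagonal.1 hx
            refine Nat.pos_of_ne_zero fun h => ?_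
            rw [h] at this; simp at this; omega
          have h2 := (H x.2 hx2).2
          calc _ ≤ 1 * |g x.2| := by gcongr
            _ ≤ _ := by rw [one_mul]; exact h2
      _ = ∑ d ∈ n.divisors, r ^ d / (1 - r) :=
          Nat.sum_divisorsAntidiagonal' (fun _ d => r ^ d / (1 - r))
      _ = (∑ d ∈ n.divisors, r ^ d) / (1 - r) := by rw [Finset.sum_div]
      _ ≤ (1 - r)⁻¹ / (1 - r) := by
          have : 0 ≤ 1 - r := by linarith
          gcongr
          rw [← tsum_geometric_of_lt_one hr0 hr1]
          exact (summable_geometric_of_lt_one hr0 hr1).sum_le_tsum _ (fun i _ => pow_nonneg hr0 i)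
  have := (abs_le.1 hb).1
  simp only [f] at this
  linarith

theorem stmt_11 (γ : K) (hγ : γ ≠ 0)
    -- no archimedean absolute value of `γ` equals `1`
    (habs : ∀ w : InfinitePlace K, w γ ≠ 1)
    (hpos : 0 < ∑ w : InfinitePlace K, lamInf K w γ) :
    ∃ c : ℝ, 0 < c ∧ ∃ n₀ : ℕ, ∀ n : ℕ, n₀ ≤ n →
      c * (Nat.totient n : ℝ) ≤ Nval K (Polynomial.eval γ (Polynomial.cyclotomic n K)) := by
  have hd : (0 : ℝ) < (Module.finrank ℚ K : ℝ)⁻¹ := by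
    have : 0 < Module.finrank ℚ K := Module.finrank_pos
    positivity
  have key : ∀ w : InfinitePlace K, ∃ C : ℝ, ∀ n : ℕ, 0 < n →
      w (Polynomial.eval γ (Polynomial.cyclotomic n K)) ≠ 0 ∧
      n.totient * Real.log (max (w γ) 1) - C ≤
        Real.log (w (Polynomial.eval γ (Polynomial.cyclotomic n K))) := by
    intro w
    obtain ⟨C, hC⟩ := aux_cyc (w.embedding γ) (by simpa using hγ)
      (by rw [InfinitePlace.norm_embedding_eq]; exact habs w)
    refine ⟨C, fun n hn => ?_⟩
    have e : w (Polynomial.eval γ (Polynomial.cyclotomic n K)) =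
        ‖(Polynomial.cyclotomic n ℂ).eval (w.embedding γ)‖ := by
      rw [← InfinitePlace.norm_embedding_eq, ← Polynomial.map_cyclotomic n w.embedding,
        Polynomial.eval_map, Polynomial.eval₂_hom]
    rw [e, ← InfinitePlace.norm_embedding_eq w γ]
    exact ⟨by simpa using (hC n hn).1, (hC n hn).2⟩
  choose C hC using key
  set H := ∑ w : InfinitePlace K, lamInf K w γ with hH
  set D := ∑ w : InfinitePlace K, (Module.finrank ℚ K : ℝ)⁻¹ * ((w.mult : ℝ) * C w) with hD
  have low : ∀ n : ℕ, 0 < n → n.totient * H - D ≤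
      Nval K (Polynomial.eval γ (Polynomial.cyclotomic n K)) := by
    intro n hn
    have e : Nval K (Polynomial.eval γ (Polynomial.cyclotomic n K)) =
        ∑ w : InfinitePlace K, (Module.finrank ℚ K : ℝ)⁻¹ * ((w.mult : ℝ) *
          Real.log (w (Polynomial.eval γ (Polynomial.cyclotomic n K)))) := by
      have := InfinitePlace.prod_eq_abs_norm (Polynomial.eval γ (Polynomial.cyclotomic n K))
      push_cast at this
      rw [Nval, ← this, Real.log_prod, Finset.mul_sum]
      · simp only [Real.log_pow]
      · intro w _
        exact pow_ne_zero _ (hC w n hn).1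
    rw [e, hH, hD, Finset.mul_sum, ← Finset.sum_sub_distrib]
    refine Finset.sum_le_sum fun w _ => ?_
    have h1 := (hC w n hn).2
    have h2 : (Module.finrank ℚ K : ℝ)⁻¹ * ((w.mult : ℝ) *
        (n.totient * Real.log (max (w γ) 1) - C w)) ≤ (Module.finrank ℚ K : ℝ)⁻¹ * ((w.mult : ℝ) *
          Real.log (w (Polynomial.eval γ (Polynomial.cyclotomic n K)))) := by gcongr
    refine le_trans (le_of_eq ?_) h2
    rw [lamInf]; ring
  obtain ⟨B, hB⟩ := exists_nat_ge (2 * D / H)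
  refine ⟨H / 2, by linarith, (2 * B).factorial + 1, fun n hn => ?_⟩
  have h1 : B ≤ n.totient := by
    by_contra hlt
    have := aux_le_factorial n B (by omega) (by omega)
    omega
  have h2 := low n (by omega)
  have h3 : 2 * D / H ≤ n.totient := hB.trans (by exact_mod_cast h1)
  rw [div_le_iff₀ hpos] at h3
  linarith
end

section
/- Let γ ∈ K^× be such that no archimedean absolute value of γ equals 1 (in particular γ is not a root of unity). Then N(Φ_n(γ))/φ(n) → Σ_{v ∈ M_K^∞} λ_v(γ) as n → ∞. -/
open NumberField Filter

variable (K : Type*) [Field K] [NumberField K]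

theorem aux_le_totient (n : ℕ) (hn : n ≠ 0) :
    n ≤ 2 * n.totient * 2 ^ n.totient := by
  obtain ⟨k, m, hm, rfl⟩ := Nat.exists_eq_two_pow_mul_odd hn
  have hpos : 0 < (2 ^ k * m).totient := Nat.totient_pos.2 (Nat.pos_of_ne_zero hn)
  have h1 : 2 ^ k ≤ 2 * (2 ^ k * m).totient := by
    rcases k with _ | k
    · simp only [pow_zero, one_mul] at *; omega
    · have hd : (2 ^ (k + 1)).totient ∣ (2 ^ (k + 1) * m).totient :=
        Nat.totient_dvd_of_dvd (Dvd.intro _ rfl)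
      have := Nat.le_of_dvd hpos hd
      rw [Nat.totient_prime_pow_succ Nat.prime_two] at this
      have e2 : 2 ^ (k + 1) = 2 ^ k * 2 := pow_succ 2 k
      omega
  have h2 : m ≤ 2 ^ (2 ^ k * m).totient := by
    have hd : m.totient ∣ (2 ^ k * m).totient := Nat.totient_dvd_of_dvd (Dvd.intro_left _ rfl)
    have hle := Nat.le_of_dvd hpos hd
    have hme : 2 ^ m.totient ≡ 1 [MOD m] :=
      Nat.ModEq.pow_totient (Nat.coprime_two_left.2 hm)
    have hmpos : 0 < m.totient := Nat.totient_pos.2 hm.pos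
    have hdd : m ∣ 2 ^ m.totient - 1 := (Nat.modEq_iff_dvd' Nat.one_le_two_pow).1 hme.symm
    have hlt : 1 < 2 ^ m.totient := Nat.one_lt_two_pow hmpos.ne'
    have := Nat.le_of_dvd (by omega) hdd
    have h3 : 2 ^ m.totient ≤ 2 ^ (2 ^ k * m).totient := Nat.pow_le_pow_right (by norm_num) hle
    omega
  exact Nat.mul_le_mul h1 h2

theorem aux_totient_tendsto : Tendsto Nat.totient atTop atTop := by
  refine tendsto_atTop.2 fun B => ?_
  filter_upwards [eventually_gt_atTop (2 * B * 2 ^ B)] with n hn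
  by_contra! h
  have h1 := aux_le_totient n (by omega)
  have h2 : 2 * n.totient * 2 ^ n.totient ≤ 2 * B * 2 ^ B := by gcongr <;> norm_num
  omega

theorem aux_log_bound (w : ℂ) (hw : ‖w‖ < 1) :
    |Real.log ‖w - 1‖| ≤ ‖w‖ / (1 - ‖w‖) := by
  have ha := norm_nonneg w
  have h0 : 0 < 1 - ‖w‖ := by linarith
  have h1 : 1 - ‖w‖ ≤ ‖w - 1‖ := by
    have := norm_sub_norm_le (1 : ℂ) w
    rw [norm_one, norm_sub_rev] at this; exact this
  have h2 : ‖w - 1‖ ≤ 1 + ‖w‖ := by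
    have := norm_sub_le w (1 : ℂ)
    rw [norm_one] at this; linarith
  have ht : 0 < ‖w - 1‖ := by linarith
  have e : ‖w‖ / (1 - ‖w‖) = (1 - ‖w‖)⁻¹ - 1 := by field_simp; ring
  have h3 : ‖w‖ ≤ ‖w‖ / (1 - ‖w‖) := by
    rw [le_div_iff₀ h0]; nlinarith
  rw [abs_le]
  constructor
  · have := Real.one_sub_inv_le_log_of_pos ht
    have h4 : ‖w - 1‖⁻¹ ≤ (1 - ‖w‖)⁻¹ := by gcongr
    linarith
  · have := Real.log_le_sub_one_of_pos ht
    linarith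

/-- the error term is geometrically small -/
theorem aux_err (z : ℂ) (hz0 : z ≠ 0) (hz : ‖z‖ ≠ 1) :
    ∃ r C : ℝ, 0 ≤ r ∧ r < 1 ∧ 0 ≤ C ∧ ∀ n : ℕ, 0 < n → z ^ n - 1 ≠ 0 ∧
      |Real.log ‖z ^ n - 1‖ - n * Real.log (max ‖z‖ 1)| ≤ C * r ^ n := by
  have key : ∀ z : ℂ, ‖z‖ < 1 → ∀ n : ℕ, 0 < n →
      |Real.log ‖z ^ n - 1‖| ≤ (1 - ‖z‖)⁻¹ * ‖z‖ ^ n := by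
    intro z h n hn
    have hle : ‖z‖ ^ n ≤ ‖z‖ := pow_le_of_le_one (norm_nonneg _) h.le hn.ne'
    have hb := aux_log_bound (z ^ n) (by rw [norm_pow]; linarith)
    rw [norm_pow] at hb
    refine hb.trans ?_
    rw [div_eq_inv_mul]
    have : 0 < 1 - ‖z‖ := by linarith
    gcongr
  have hne : ∀ n : ℕ, 0 < n → z ^ n - 1 ≠ 0 := by
    intro n hn h
    have h1 : z ^ n = 1 := sub_eq_zero.1 h
    have h2 : ‖z‖ ^ n = 1 := by rw [← norm_pow, h1, norm_one]
    exact hz ((pow_eq_one_iff_of_nonneg (norm_nonneg _) hn.ne').1 h2)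
  rcases lt_or_gt_of_ne hz with h | h
  · refine ⟨‖z‖, (1 - ‖z‖)⁻¹, norm_nonneg _, h, inv_nonneg.2 (by linarith), fun n hn => ⟨hne n hn, ?_⟩⟩
    rw [max_eq_right h.le]
    simpa using key z h n hn
  · have h' : ‖z⁻¹‖ < 1 := by rw [norm_inv]; exact inv_lt_one_of_one_lt₀ h
    refine ⟨‖z⁻¹‖, (1 - ‖z⁻¹‖)⁻¹, norm_nonneg _, h', inv_nonneg.2 (by linarith),
      fun n hn => ⟨hne n hn, ?_⟩⟩
    rw [max_eq_left h.le]
    refine le_trans (le_of_eq ?_) (key z⁻¹ h' n hn)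
    congr 1
    have e : z⁻¹ ^ n - 1 = - ((z ^ n - 1) / z ^ n) := by
      rw [inv_pow]
      have := pow_ne_zero n hz0
      field_simp; ring
    rw [e, norm_neg, norm_div, Real.log_div (norm_ne_zero_iff.2 (hne n hn))
      (norm_ne_zero_iff.2 (pow_ne_zero _ hz0)), norm_pow, Real.log_pow]

theorem aux_main (z : ℂ) (hz0 : z ≠ 0) (hz : ‖z‖ ≠ 1) :
    (∀ n : ℕ, 0 < n → (Polynomial.cyclotomic n ℂ).eval z ≠ 0) ∧
    Tendsto (fun n : ℕ => Real.log ‖(Polynomial.cyclotomic n ℂ).eval z‖ / (n.totient : ℝ))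
      atTop (nhds (Real.log (max ‖z‖ 1))) := by
  obtain ⟨r, C, hr0, hr1, hC, hE⟩ := aux_err z hz0 hz
  set L := Real.log (max ‖z‖ 1) with hL
  have hprod : ∀ n : ℕ, 0 < n →
      ∏ i ∈ n.divisors, (Polynomial.cyclotomic i ℂ).eval z = z ^ n - 1 := by
    intro n hn
    rw [← Polynomial.eval_prod, Polynomial.prod_cyclotomic_eq_X_pow_sub_one hn]
    simp
  have hne : ∀ n : ℕ, 0 < n → (Polynomial.cyclotomic n ℂ).eval z ≠ 0 := by
    intro n hn h
    apply (hE n hn).1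
    rw [← hprod n hn]
    exact Finset.prod_eq_zero (Nat.mem_divisors_self n hn.ne') h
  refine ⟨hne, ?_⟩
  set g : ℕ → ℝ := fun n => Real.log ‖(Polynomial.cyclotomic n ℂ).eval z‖ - n.totient * L with hg
  set e : ℕ → ℝ := fun n => Real.log ‖z ^ n - 1‖ - n * L with he
  have hsum : ∀ n > 0, ∑ i ∈ n.divisors, g i = e n := by
    intro n hn
    simp only [hg, he]
    rw [Finset.sum_sub_distrib, ← Finset.sum_mul, ← Nat.cast_sum, Nat.sum_totient,
      ← hprod n hn, norm_prod, Real.log_prod]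
    intro i hi
    exact norm_ne_zero_iff.2 (hne i (Nat.pos_of_mem_divisors hi))
  have hinv := ArithmeticFunction.sum_eq_iff_sum_mul_moebius_eq.1 hsum
  have hbd : ∀ n > 0, |g n| ≤ C * (1 - r)⁻¹ := by
    intro n hn
    rw [← hinv n hn]
    calc _ ≤ ∑ x ∈ n.divisorsAntidiagonal, |(ArithmeticFunction.moebius x.1 : ℝ) * e x.2| :=
          Finset.abs_sum_le_sum_abs _ _
      _ ≤ ∑ x ∈ n.divisorsAntidiagonal, C * r ^ x.2 := by
          refine Finset.sum_le_sum fun x hx => ?_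
          have hx2 : 0 < x.2 := Nat.pos_of_ne_zero (Nat.ne_zero_of_mem_divisorsAntidiagonal hx).2
          rw [abs_mul]
          have hmu : |(ArithmeticFunction.moebius x.1 : ℝ)| ≤ 1 := by
            exact_mod_cast ArithmeticFunction.abs_moebius_le_one
          calc _ ≤ 1 * |e x.2| := by gcongr
            _ ≤ _ := by rw [one_mul]; exact (hE _ hx2).2
      _ = ∑ d ∈ n.divisors, C * r ^ d :=
          Nat.sum_divisorsAntidiagonal' (n := n) (fun _ d => C * r ^ d)
      _ = C * ∑ d ∈ n.divisors, r ^ d := by rw [Finset.mul_sum]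
      _ ≤ C * (1 - r)⁻¹ := by
          gcongr
          rw [← tsum_geometric_of_lt_one hr0 hr1]
          exact (summable_geometric_of_lt_one hr0 hr1).sum_le_tsum _ (fun i _ => pow_nonneg hr0 i)
  have ht : Tendsto (fun n : ℕ => (n.totient : ℝ)) atTop atTop :=
    tendsto_natCast_atTop_atTop.comp aux_totient_tendsto
  have h0 : Tendsto (fun n : ℕ => g n / (n.totient : ℝ)) atTop (nhds 0) := by
    refine squeeze_zero_norm' ?_ (ht.const_div_atTop (C * (1 - r)⁻¹))
    filter_upwards [eventually_gt_atTop 0] with n hn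
    rw [norm_div, Real.norm_eq_abs, Real.norm_natCast]
    have := hbd n hn
    gcongr
  have h1 := h0.add_const L
  rw [zero_add] at h1
  refine h1.congr' ?_
  filter_upwards [eventually_gt_atTop 0] with n hn
  have : (n.totient : ℝ) ≠ 0 := by exact_mod_cast (Nat.totient_pos.2 hn).ne'
  simp only [hg]
  field_simp
  ring

theorem stmt_12 (γ : K) (hγ : γ ≠ 0)
    -- no archimedean absolute value of `γ` equals `1`
    (habs : ∀ w : InfinitePlace K, w γ ≠ 1) :
    Tendsto
      (fun n : ℕ =>
        Nval K (Polynomial.eval γ (Polynomial.cyclotomic n K)) / (Nat.totient n : ℝ))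
      atTop (nhds (∑ w : InfinitePlace K, lamInf K w γ)) := by
  have hw : ∀ (w : InfinitePlace K) (n : ℕ),
      w (Polynomial.eval γ (Polynomial.cyclotomic n K)) =
        ‖(Polynomial.cyclotomic n ℂ).eval (w.embedding γ)‖ := by
    intro w n
    rw [← InfinitePlace.norm_embedding_eq, ← Polynomial.map_cyclotomic n w.embedding,
      Polynomial.eval_map_apply]
  have hm : ∀ w : InfinitePlace K, _ := fun w => aux_main (w.embedding γ)
    ((map_ne_zero w.embedding).2 hγ)
    (by rw [InfinitePlace.norm_embedding_eq]; exact habs w)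
  have hT : Tendsto (fun n : ℕ => ∑ w : InfinitePlace K, (Module.finrank ℚ K : ℝ)⁻¹ *
      ((w.mult : ℝ) * (Real.log ‖(Polynomial.cyclotomic n ℂ).eval (w.embedding γ)‖ /
        (n.totient : ℝ)))) atTop (nhds (∑ w : InfinitePlace K, lamInf K w γ)) := by
    refine tendsto_finsetSum _ fun w _ => ?_
    have := ((hm w).2.const_mul (w.mult : ℝ)).const_mul (Module.finrank ℚ K : ℝ)⁻¹
    rw [InfinitePlace.norm_embedding_eq] at this
    exact this
  refine hT.congr' ?_
  filter_upwards [eventually_gt_atTop 0] with n hn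
  unfold Nval
  have hnorm := InfinitePlace.prod_eq_abs_norm (Polynomial.eval γ (Polynomial.cyclotomic n K))
  have hnorm' : |((Algebra.norm ℚ (Polynomial.eval γ (Polynomial.cyclotomic n K)) : ℚ) : ℝ)| =
      ∏ w : InfinitePlace K, w (Polynomial.eval γ (Polynomial.cyclotomic n K)) ^ w.mult := by
    rw [hnorm]; push_cast; rfl
  rw [hnorm', Real.log_prod, Finset.mul_sum, Finset.sum_div]
  · refine Finset.sum_congr rfl fun w _ => ?_
    rw [Real.log_pow, hw]
    ring
  · intro w _
    rw [hw]
    exact pow_ne_zero _ (norm_ne_zero_iff.2 ((hm w).1 n hn))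
end

section
/- Let K be an algebraically closed field and let V ⊆ (K^×)^n be a Zariski-closed subset of the torus (i.e., V is the set of common zeros in (K^×)^n of a family of polynomials in n variables) which is also a proper subgroup of (K^×)^n under coordinatewise multiplication. Then there exist integers e_1,…,e_n, not all zero, such that every (x_1,…,x_n) ∈ V satisfies x_1^{e_1}·x_2^{e_2}·⋯·x_n^{e_n} = 1. -/
theorem stmt_16 (K : Type*) [Field K] [IsAlgClosed K] (n : ℕ)
    (V : Set (Fin n → Kˣ))
    -- `V` is Zariski closed in the torus: the common zero set of a family of polynomials
    (hclosed : ∃ T : Set (MvPolynomial (Fin n) K),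
      V = {x : Fin n → Kˣ | ∀ f ∈ T, MvPolynomial.eval (fun i => (x i : K)) f = 0})
    -- `V` is a subgroup of `(K^×)^n` under coordinatewise multiplication
    (hsub : ∃ H : Subgroup (Fin n → Kˣ), V = (H : Set (Fin n → Kˣ)))
    -- and it is a proper subgroup
    (hproper : V ≠ Set.univ) :
    ∃ e : Fin n → ℤ, e ≠ 0 ∧ ∀ x ∈ V, ∏ i, x i ^ e i = 1 := by
  obtain ⟨T, hT⟩ := hclosed
  obtain ⟨H, hH⟩ := hsub
  obtain ⟨f, hfT, hf0⟩ : ∃ f ∈ T, f ≠ 0 := by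
    by_contra! h
    apply hproper
    rw [hT]
    ext x
    simp only [Set.mem_setOf_eq, Set.mem_univ, iff_true]
    intro f hf
    rw [h f hf, map_zero]
  have hfV : ∀ x ∈ H, MvPolynomial.eval (fun i => (x i : K)) f = 0 := by
    intro x hx
    have h1 : x ∈ V := by rw [hH]; exact hx
    rw [hT] at h1
    exact h1 f hfT
  -- the characters of `H` given by monomials
  let χ : (Fin n →₀ ℕ) → (H →* K) := fun m =>
    { toFun := fun x => ∏ i, ((x.1 i : Kˣ) : K) ^ m i
      map_one' := by simp
      map_mul' := by
        intro x y
        simp [mul_pow, Finset.prod_mul_distrib] }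
  have hχ : ∀ m (x : H), χ m x = ∏ i, ((x.1 i : Kˣ) : K) ^ m i := fun _ _ => rfl
  have hninj : ¬ Function.Injective χ := by
    intro hinj
    have hli := (linearIndependent_monoidHom H K).comp χ hinj
    rw [linearIndependent_iff'] at hli
    apply hf0
    ext m
    by_cases hm : m ∈ f.support
    · refine (hli f.support (fun m => f.coeff m) ?_ m hm).trans (by simp)
      funext x
      have h2 := hfV x.1 x.2
      rw [MvPolynomial.eval_eq'] at h2
      simpa [Finset.sum_apply, hχ] using h2
    · simpa using hm
  simp only [Function.Injective, not_forall] at hninj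
  obtain ⟨a, b, hab, hne⟩ := hninj
  refine ⟨fun i => (a i : ℤ) - b i, ?_, ?_⟩
  · intro h
    apply hne
    ext i
    have := congrFun h i
    simp only [Pi.zero_apply] at this
    omega
  · intro x hx
    rw [hH] at hx
    have h3 := DFunLike.congr_fun hab ⟨x, hx⟩
    rw [hχ, hχ] at h3
    have h4 : ∏ i, x i ^ a i = ∏ i, x i ^ b i := by
      ext
      push_cast
      exact h3
    simp only [zpow_sub, zpow_natCast, Finset.prod_mul_distrib, Finset.prod_inv_distrib]
    rw [h4, mul_inv_cancel]
end

section
/- Let K be a field of characteristic zero and let a_1,…,a_m ∈ K^× be multiplicatively independent, i.e., a_1^{e_1}·⋯·a_m^{e_m} = 1 with e_1,…,e_m ∈ ℤ implies e_1 = ⋯ = e_m = 0. Let r_0 = (r_0^{(1)},…,r_0^{(m)}) ∈ (K^×)^m. Then the orbit { (r_0^{(1)} a_1^k, …, r_0^{(m)} a_m^k) : k ∈ ℕ } is Zariski dense in affine m-space: any polynomial f ∈ K[Y_1,…,Y_m] that vanishes at (r_0^{(1)} a_1^k, …, r_0^{(m)} a_m^k) for infinitely many k ∈ ℕ is the zero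 polynomial. -/
open Filter Topology

theorem padic_exp_radius_pos (p : ℕ) [hp : Fact p.Prime] (E : Type*) [NormedField E]
    [NormedAlgebra ℚ_[p] E] : 0 < (NormedSpace.expSeries ℚ_[p] E).radius := by
  have hp0 : (0 : ℝ) < p := by exact_mod_cast hp.1.pos
  have h : (((p : NNReal)⁻¹ : NNReal) : ENNReal) ≤ (NormedSpace.expSeries ℚ_[p] E).radius := by
    refine FormalMultilinearSeries.le_radius_of_bound _ 1 fun n => ?_
    have h1 : ‖NormedSpace.expSeries ℚ_[p] E n‖ ≤ (p : ℝ) ^ n := by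
      unfold NormedSpace.expSeries
      rw [norm_smul, ContinuousMultilinearMap.norm_mkPiAlgebraFin, mul_one, norm_inv]
      have h2 : ‖((n.factorial : ℕ) : ℚ_[p])‖ = (p : ℝ) ^ (-(padicValNat p n.factorial : ℤ)) := by
        have h3 : ((n.factorial : ℕ) : ℚ_[p]) ≠ 0 := Nat.cast_ne_zero.2 n.factorial_ne_zero
        rw [Padic.norm_eq_zpow_neg_valuation h3,
          Padic.valuation_natCast]
      rw [h2, zpow_neg, inv_inv, zpow_natCast]
      exact pow_le_pow_right₀ (by exact_mod_cast hp.1.one_le) (padicValNat_factorial_le p n)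
    push_cast
    rw [inv_pow]
    calc _ ≤ (p : ℝ) ^ n * ((p : ℝ) ^ n)⁻¹ := by gcongr
      _ = 1 := mul_inv_cancel₀ (by positivity)
  refine lt_of_lt_of_le ?_ h
  simp

/-- Simultaneous recurrence to `1` of powers of norm one elements. -/
theorem exists_pow_near_one (p : ℕ) [hp : Fact p.Prime] (E : Type*) [NormedField E]
    [NormedAlgebra ℚ_[p] E] [FiniteDimensional ℚ_[p] E] {n : ℕ} (l : Fin n → E)
    (hl : ∀ i, ‖l i‖ = 1) (δ : ℝ) (hδ : 0 < δ) :
    ∃ N : ℕ, 0 < N ∧ ∀ i, ‖l i ^ N - 1‖ < δ := by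
  have : ProperSpace (Fin n → E) := FiniteDimensional.proper ℚ_[p] (Fin n → E)
  let v : ℕ → (Fin n → E) := fun k i => l i ^ k
  have hv : ∀ k, v k ∈ Metric.closedBall (0 : Fin n → E) 1 := by
    intro k
    rw [mem_closedBall_zero_iff, pi_norm_le_iff_of_nonneg zero_le_one]
    intro i
    simp [v, hl]
  obtain ⟨a, -, φ, hφ, ha⟩ := tendsto_subseq_of_bounded Metric.isBounded_closedBall hv
  obtain ⟨M, hM⟩ := Metric.cauchySeq_iff'.1 ha.cauchySeq δ hδ
  have h1 := hM (M + 1) (Nat.le_succ M)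
  have h2 : φ M < φ (M + 1) := hφ (Nat.lt_succ_self M)
  refine ⟨φ (M + 1) - φ M, by omega, fun i => ?_⟩
  have h3 := (dist_pi_lt_iff hδ).1 h1 i
  have h4 : φ (M + 1) = φ M + (φ (M + 1) - φ M) := by omega
  simp only [v, Function.comp] at h3
  rw [dist_eq_norm, h4, pow_add] at h3
  have h5 : l i ^ φ M * l i ^ (φ (M + 1) - φ M) - l i ^ φ M
     = l i ^ φ M * (l i ^ (φ (M + 1) - φ M) - 1) := by ring
  rw [h5, norm_mul, norm_pow, hl, one_pow, one_mul] at h3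
  exact h3

theorem padic_exists_log (p : ℕ) [hp : Fact p.Prime] (E : Type*) [NormedField E]
    [NormedAlgebra ℚ_[p] E] [FiniteDimensional ℚ_[p] E] :
    ∃ δ : ℝ, 0 < δ ∧ ∀ u : E, ‖u - 1‖ < δ →
      ∃ L ∈ Metric.eball (0 : E) (NormedSpace.expSeries ℚ_[p] E).radius,
        NormedSpace.exp L = u := by
  have : CompleteSpace E := FiniteDimensional.complete ℚ_[p] E
  have hr := padic_exp_radius_pos p E
  have h := hasStrictFDerivAt_exp_zero_of_radius_pos (𝕂 := ℚ_[p]) (𝔸 := E) hr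
  have h2 := h.map_nhds_eq_of_surj (LinearMap.range_eq_top.2 fun x => ⟨x, rfl⟩)
  rw [NormedSpace.exp_zero] at h2
  have h3 : NormedSpace.exp '' Metric.eball (0 : E) (NormedSpace.expSeries ℚ_[p] E).radius
      ∈ 𝓝 (1 : E) := by
    rw [← h2]
    exact image_mem_map (Metric.eball_mem_nhds _ hr)
  obtain ⟨δ, hδ, hb⟩ := Metric.mem_nhds_iff.1 h3
  refine ⟨δ, hδ, fun u hu => ?_⟩
  exact hb (by rwa [Metric.mem_ball, dist_eq_norm])

theorem padic_smul_mem (p : ℕ) [hp : Fact p.Prime] (E : Type*) [NormedField E]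
    [NormedAlgebra ℚ_[p] E] {r : ENNReal} {L : E} (hL : L ∈ Metric.eball (0 : E) r)
    {x : ℚ_[p]} (hx : ‖x‖ ≤ 1) : x • L ∈ Metric.eball (0 : E) r := by
  rw [mem_eball_zero_iff] at hL ⊢
  refine lt_of_le_of_lt ?_ hL
  rw [enorm_le_iff_norm_le, norm_smul]
  exact mul_le_of_le_one_left (norm_nonneg _) hx

theorem padic_exp_nat (p : ℕ) [hp : Fact p.Prime] (E : Type*) [NormedField E]
    [NormedAlgebra ℚ_[p] E] [FiniteDimensional ℚ_[p] E] {L : E}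
    (hL : L ∈ Metric.eball (0 : E) (NormedSpace.expSeries ℚ_[p] E).radius) (k : ℕ) :
    NormedSpace.exp ((k : ℚ_[p]) • L) = NormedSpace.exp L ^ k := by
  have : CompleteSpace E := FiniteDimensional.complete ℚ_[p] E
  induction k with
  | zero => simp
  | succ k ih =>
    push_cast
    rw [add_smul, one_smul, pow_succ, ← ih]
    refine NormedSpace.exp_add_of_mem_ball (𝕂 := ℚ_[p]) (padic_smul_mem p E hL ?_) hL
    exact (by exact_mod_cast Padic.norm_int_le_one (p := p) (k : ℤ))

theorem padic_sml (p : ℕ) [hp : Fact p.Prime] (E : Type*) [NormedField E]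
    [NormedAlgebra ℚ_[p] E] [FiniteDimensional ℚ_[p] E] {n : ℕ} (l c : Fin n → E)
    (hl : ∀ i, ‖l i‖ = 1) (hd : ∀ N : ℕ, 0 < N → ∀ i j, l i ^ N = l j ^ N → i = j)
    (hz : {k : ℕ | ∑ i, c i * l i ^ k = 0}.Infinite) : c = 0 := by
  have : CompleteSpace E := FiniteDimensional.complete ℚ_[p] E
  obtain ⟨δ, hδ, hlog⟩ := padic_exists_log p E
  obtain ⟨N, hN, hlN⟩ := exists_pow_near_one p E l hl δ hδ
  choose L hLb hLe using fun i => hlog _ (hlN i)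
  -- pigeonhole on residues modulo `N`
  obtain ⟨s, hs⟩ : ∃ s : ℕ, {k : ℕ | ∑ i, c i * l i ^ (s + N * k) = 0}.Infinite := by
    by_contra! hcon
    refine hz ?_
    have : {k : ℕ | ∑ i, c i * l i ^ k = 0} ⊆ ⋃ s ∈ Finset.range N,
        (fun k => s + N * k) '' {k : ℕ | ∑ i, c i * l i ^ (s + N * k) = 0} := by
      intro k hk
      simp only [Set.mem_iUnion]
      refine ⟨k % N, Finset.mem_range.2 (Nat.mod_lt _ hN), k / N, ?_, Nat.mod_add_div k N⟩
      rw [Set.mem_ofPred_eq, Nat.mod_add_div]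
      exact hk
    refine Set.Finite.subset ?_ this
    refine Set.Finite.biUnion (Finset.finite_toSet _) fun s _ => Set.Finite.image _ ?_
    exact hcon s
  let F : ℚ_[p] → E := fun x => ∑ i, (c i * l i ^ s) * NormedSpace.exp (x • L i)
  have hF : ∀ k : ℕ, F k = ∑ i, c i * l i ^ (s + N * k) := by
    intro k
    refine Finset.sum_congr rfl fun i _ => ?_
    rw [padic_exp_nat p E (hLb i), hLe, pow_add, pow_mul, mul_assoc]
  have hFa : ∀ x : ℚ_[p], ‖x‖ ≤ 1 → AnalyticAt ℚ_[p] F x := by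
    intro x hx
    refine Finset.analyticAt_fun_sum _ fun i _ => ?_
    refine analyticAt_const.mul ?_
    refine AnalyticAt.fun_comp (g := NormedSpace.exp) (f := fun x : ℚ_[p] => x • L i) ?_ ?_
    · exact NormedSpace.analyticAt_exp_of_mem_ball _ (padic_smul_mem p E (hLb i) hx)
    · exact analyticAt_id.smul analyticAt_const
  -- accumulation point of zeros
  have hinf : ((fun k : ℕ => (k : ℚ_[p])) '' {k : ℕ | F k = 0}).Infinite := by
    refine Set.Infinite.image (Nat.cast_injective.injOn) ?_
    simpa only [hF] using hs
  obtain ⟨x, hxB, hx⟩ := hinf.exists_accPt_of_subset_isCompact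
    (isCompact_closedBall (0 : ℚ_[p]) 1) (by
      rintro _ ⟨k, -, rfl⟩
      rw [mem_closedBall_zero_iff]
      exact (by exact_mod_cast Padic.norm_int_le_one (p := p) (k : ℤ)))
  rw [mem_closedBall_zero_iff] at hxB
  have hfreq : ∃ᶠ y in 𝓝[≠] x, F y = 0 := by
    rw [accPt_iff_frequently_nhdsNE] at hx
    refine hx.mono ?_
    rintro _ ⟨k, hk, rfl⟩
    exact hk
  have hev : ∀ᶠ y in 𝓝 x, F y = 0 := (hFa x hxB).frequently_zero_iff_eventually_zero.1 hfreq
  -- find an arithmetic progression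
  obtain ⟨ε, hε, hb⟩ := Metric.eventually_nhds_iff.1 hev
  obtain ⟨k0, hk0⟩ : ∃ k : ℕ, dist (k : ℚ_[p]) x < ε := by
    have h1 : ∃ᶠ y in 𝓝[≠] x, y ∈ (fun k : ℕ => (k : ℚ_[p])) '' {k : ℕ | F k = 0} := by
      rwa [accPt_iff_frequently_nhdsNE] at hx
    have h2 : ∀ᶠ y in 𝓝[≠] x, dist y x < ε :=
      eventually_nhdsWithin_of_eventually_nhds (Metric.ball_mem_nhds x hε)
    obtain ⟨_, ⟨k, -, rfl⟩, h4⟩ := (h1.and_eventually h2).exists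
    exact ⟨k, h4⟩
  obtain ⟨t, ht⟩ : ∃ t : ℕ, ((p : ℝ)⁻¹) ^ t < ε - dist (k0 : ℚ_[p]) x :=
    exists_pow_lt_of_lt_one (by linarith) (inv_lt_one_of_one_lt₀ (by exact_mod_cast hp.1.one_lt))
  have hall : ∀ k : ℕ, ∑ i, (c i * l i ^ (s + N * k0)) * (l i ^ (N * p ^ t)) ^ k = 0 := by
    intro k
    have h1 : F ((k0 + p ^ t * k : ℕ) : ℚ_[p]) = 0 := by
      apply hb
      have h2 : dist ((k0 + p ^ t * k : ℕ) : ℚ_[p]) (k0 : ℚ_[p]) ≤ ((p : ℝ)⁻¹) ^ t := by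
        rw [dist_eq_norm]
        push_cast
        rw [add_sub_cancel_left, norm_mul, norm_pow, Padic.norm_p]
        refine mul_le_of_le_one_right (by positivity) ?_
        exact (by exact_mod_cast Padic.norm_int_le_one (p := p) (k : ℤ))
      have := dist_triangle ((k0 + p ^ t * k : ℕ) : ℚ_[p]) (k0 : ℚ_[p]) x
      linarith
    rw [hF] at h1
    rw [← h1]
    refine Finset.sum_congr rfl fun i _ => ?_
    rw [mul_assoc, ← pow_mul, ← pow_add]
    congr 2
    ring
  have hvan := Matrix.eq_zero_of_forall_pow_sum_mul_pow_eq_zero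
    (v := fun i => c i * l i ^ (s + N * k0)) (f := fun i => l i ^ (N * p ^ t))
    (fun i j hij => hd _ (Nat.mul_pos hN (pow_pos hp.1.pos t)) i j hij) (fun k => hall k)
  funext i
  have h1 := congrFun hvan i
  simp only [Pi.zero_apply, mul_eq_zero] at h1
  rcases h1 with h1 | h1
  · exact h1
  · exfalso
    have h2 := hl i
    rw [eq_zero_of_pow_eq_zero h1] at h2
    simp at h2

theorem exists_algIndep_padic (p : ℕ) [hp : Fact p.Prime] (σ : Type*) [Finite σ] (a : σ → ℤ) :
    ∃ τ : σ → ℚ_[p], AlgebraicIndependent ℤ τ ∧ ∀ i, ‖τ i - a i‖ < 1 := by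
  obtain ⟨ι, x, hx⟩ := exists_isTranscendenceBasis' ℤ ℚ_[p]
  have hinf : Infinite ι := by
    by_contra hfin
    rw [not_infinite_iff_finite] at hfin
    have halg := hx.isAlgebraic
    have hcR : Cardinal.mk (Algebra.adjoin ℤ (Set.range x)) ≤ Cardinal.aleph0 := by
      rw [Cardinal.mk_le_aleph0_iff]
      have : Countable (MvPolynomial ι ℤ) := by
        rw [← Cardinal.mk_le_aleph0_iff]
        refine MvPolynomial.cardinalMk_le_max_lift.trans ?_
        simp
      exact (hx.1.aevalEquiv.toEquiv.symm.injective).countable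
    have h1 := Algebra.IsAlgebraic.cardinalMk_le_max (Algebra.adjoin ℤ (Set.range x)) ℚ_[p]
    have h2 := continuum_le_cardinal_of_nontriviallyNormedField ℚ_[p]
    rw [max_eq_right hcR] at h1
    exact absurd (h2.trans h1) (not_le.2 Cardinal.aleph0_lt_continuum)
  obtain ⟨e⟩ : Nonempty (σ ↪ ι) := by
    obtain ⟨n, ⟨e⟩⟩ := Finite.exists_equiv_fin σ
    exact ⟨(e.toEmbedding.trans Fin.valEmbedding).trans (Infinite.natEmbedding ι)⟩
  have hind : AlgebraicIndependent ℤ (x ∘ e) := hx.1.comp e e.injective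
  have hk : ∀ i, ∃ k : ℕ, ‖(p : ℚ_[p]) ^ k * x (e i)‖ < 1 := by
    intro i
    have h1 : Tendsto (fun k : ℕ => (p : ℚ_[p]) ^ k * x (e i)) atTop (𝓝 (0 * x (e i))) :=
      (tendsto_pow_atTop_nhds_zero_of_norm_lt_one Padic.norm_p_lt_one).mul_const _
    rw [zero_mul] at h1
    have h2 := h1.norm
    rw [norm_zero] at h2
    exact (h2.eventually (gt_mem_nhds zero_lt_one)).exists
  choose k hk using hk
  refine ⟨_, hind.polynomial_aeval_of_transcendental
    (f := fun i => Polynomial.C ((p : ℤ) ^ k i) * Polynomial.X + Polynomial.C (a i)) ?_, ?_⟩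
  · intro i
    have hne : ((p : ℤ) ^ k i) ≠ 0 := pow_ne_zero _ (by exact_mod_cast hp.1.ne_zero)
    refine Polynomial.transcendental _ ?_ ?_
    · rw [Polynomial.natDegree_linear hne]; exact one_ne_zero
    · rw [Polynomial.leadingCoeff_linear hne]
      exact mem_nonZeroDivisors_of_ne_zero hne
  · intro i
    simpa using hk i

theorem norm_aeval_padic (p : ℕ) [hp : Fact p.Prime] (σ : Type*) (a : σ → ℤ)
    (τ : σ → ℚ_[p]) (hτ : ∀ i, ‖τ i - a i‖ < 1) (g : MvPolynomial σ ℤ) :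
    ‖MvPolynomial.aeval τ g‖ ≤ 1 ∧
      ‖MvPolynomial.aeval τ g - ((MvPolynomial.eval a g : ℤ) : ℚ_[p])‖ < 1 := by
  have hτ1 : ∀ i, ‖τ i‖ ≤ 1 := by
    intro i
    have h1 : τ i = (τ i - a i) + a i := by ring
    rw [h1]
    exact (Padic.nonarchimedean _ _).trans (max_le (hτ i).le (Padic.norm_int_le_one _))
  induction g using MvPolynomial.induction_on with
  | C z => simpa using Padic.norm_int_le_one (p := p) z
  | add f g hf hg =>
    rw [map_add, map_add]
    refine ⟨(Padic.nonarchimedean _ _).trans (max_le hf.1 hg.1), ?_⟩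
    push_cast
    rw [add_sub_add_comm]
    exact (Padic.nonarchimedean _ _).trans_lt (max_lt hf.2 hg.2)
  | mul_X f i hf =>
    rw [map_mul, map_mul, MvPolynomial.aeval_X, MvPolynomial.eval_X]
    refine ⟨by rw [norm_mul]; exact mul_le_one₀ hf.1 (norm_nonneg _) (hτ1 i), ?_⟩
    push_cast
    have h1 : MvPolynomial.aeval τ f * τ i - ((MvPolynomial.eval a f : ℤ) : ℚ_[p]) * (a i : ℚ_[p])
      = MvPolynomial.aeval τ f * (τ i - a i)
        + (MvPolynomial.aeval τ f - ((MvPolynomial.eval a f : ℤ) : ℚ_[p])) * (a i : ℚ_[p]) := by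
      ring
    rw [h1]
    refine (Padic.nonarchimedean _ _).trans_lt (max_lt ?_ ?_)
    · rw [norm_mul]
      exact (mul_le_of_le_one_left (norm_nonneg _) hf.1).trans_lt (hτ i)
    · rw [norm_mul]
      exact (mul_le_of_le_one_right (norm_nonneg _) (Padic.norm_int_le_one _)).trans_lt hf.2

theorem exists_padic_spec (σ : Type*) [Finite σ] (g : MvPolynomial σ ℤ) (hg : g ≠ 0) :
    ∃ (p : ℕ) (_ : Fact p.Prime) (τ : σ → ℚ_[p]), AlgebraicIndependent ℤ τ ∧
      (∀ h : MvPolynomial σ ℤ, ‖MvPolynomial.aeval τ h‖ ≤ 1) ∧ ‖MvPolynomial.aeval τ g‖ = 1 := by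
  obtain ⟨a, ha⟩ : ∃ a : σ → ℤ, MvPolynomial.eval a g ≠ 0 := by
    by_contra! hcon
    exact hg (MvPolynomial.funext fun x => by rw [hcon x, map_zero])
  obtain ⟨p, hp1, hp⟩ := Nat.exists_infinite_primes ((MvPolynomial.eval a g).natAbs + 1)
  have hpf : Fact p.Prime := ⟨hp⟩
  obtain ⟨τ, hτ, hτa⟩ := exists_algIndep_padic p σ a
  have h1 := norm_aeval_padic p σ a τ hτa
  refine ⟨p, hpf, τ, hτ, fun h => (h1 h).1, le_antisymm (h1 g).1 ?_⟩
  by_contra! hlt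
  have h2 : ‖((MvPolynomial.eval a g : ℤ) : ℚ_[p])‖ < 1 := by
    have h3 : ((MvPolynomial.eval a g : ℤ) : ℚ_[p]) = MvPolynomial.aeval τ g
      + -(MvPolynomial.aeval τ g - ((MvPolynomial.eval a g : ℤ) : ℚ_[p])) := by ring
    rw [h3]
    refine (Padic.nonarchimedean _ _).trans_lt (max_lt hlt ?_)
    rw [norm_neg]
    exact (h1 g).2
  rw [Padic.norm_intCast_lt_one_iff] at h2
  have h4 := Int.natAbs_dvd_natAbs.2 h2
  rw [Int.natAbs_natCast] at h4
  have h5 := Nat.le_of_dvd (Int.natAbs_pos.2 ha) h4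
  omega

theorem norm_le_one_of_isIntegral_padic (p : ℕ) [hp : Fact p.Prime] {R : Type*} [CommRing R]
    (ψ : R →+* PadicAlgCl p) (hψ : ∀ r, ‖ψ r‖ ≤ 1) (x : PadicAlgCl p)
    (hx : ψ.IsIntegralElem x) : ‖x‖ ≤ 1 := by
  obtain ⟨f, hf, hfx⟩ := hx
  let v : Valuation (PadicAlgCl p) NNReal := (PadicAlgCl.valued p).v
  let ψ' : R →+* v.integer := ψ.codRestrict v.integer fun r => by
    rw [Valuation.mem_integer_iff]
    exact hψ r
  have hint : IsIntegral v.integer x := by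
    refine ⟨f.map ψ', hf.map _, ?_⟩
    rw [Polynomial.eval₂_map]
    exact hfx
  have h1 := (Valuation.integer.integers v).mem_of_integral hint
  rw [Valuation.mem_integer_iff] at h1
  exact h1

theorem exists_padic_embedding (A : Type*) [CommRing A] [IsDomain A] [CharZero A]
    [Algebra.FiniteType ℤ A] (S : Finset A) :
    ∃ (p : ℕ) (_ : Fact p.Prime) (φ : A →+* PadicAlgCl p), Function.Injective φ ∧
      ∀ z ∈ S, ‖φ z‖ ≤ 1 := by
  obtain ⟨ι, x, hx⟩ := exists_isTranscendenceBasis' ℤ A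
  have hfin : Finite ι := by
    have h1 := hx.cardinalMk_eq_trdeg
    rw [← Cardinal.lt_aleph0_iff_finite, h1]
    exact trdeg_lt_aleph0_of_finiteType
  have halg := hx.isAlgebraic
  obtain ⟨y, hy0, hy⟩ := Algebra.IsAlgebraic.exists_integral_multiples
    (Algebra.adjoin ℤ (Set.range x)) S
  obtain ⟨p, hp, τ, hτ, hτ1, hτy⟩ := exists_padic_spec ι (hx.1.aevalEquiv.symm y)
    (by simpa using hy0)
  let ψ : Algebra.adjoin ℤ (Set.range x) →+* PadicAlgCl p :=
    (algebraMap ℚ_[p] (PadicAlgCl p)).comp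
      ((MvPolynomial.aeval τ : MvPolynomial ι ℤ →ₐ[ℤ] ℚ_[p]).toRingHom.comp
        (hx.1.aevalEquiv.symm : _ →ₐ[ℤ] MvPolynomial ι ℤ).toRingHom)
  have hψinj : Function.Injective ψ := by
    refine (algebraMap ℚ_[p] (PadicAlgCl p)).injective.comp ?_
    exact Function.Injective.comp (g := MvPolynomial.aeval τ) hτ hx.1.aevalEquiv.symm.injective
  have hψn : ∀ r, ‖ψ r‖ = ‖MvPolynomial.aeval τ (hx.1.aevalEquiv.symm r)‖ :=
    fun r => PadicAlgCl.norm_extends p _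
  let _ : Algebra (Algebra.adjoin ℤ (Set.range x)) (PadicAlgCl p) := ψ.toAlgebra
  have : FaithfulSMul (Algebra.adjoin ℤ (Set.range x)) (PadicAlgCl p) :=
    (faithfulSMul_iff_algebraMap_injective _ _).2 hψinj
  let φ : A →ₐ[Algebra.adjoin ℤ (Set.range x)] PadicAlgCl p := IsAlgClosed.lift
  have hφψ : ∀ r, φ (algebraMap _ A r) = ψ r := fun r => φ.commutes r
  refine ⟨p, hp, φ.toRingHom, ?_, ?_⟩
  · rw [injective_iff_map_eq_zero]
    intro z hz
    by_contra hz0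
    obtain ⟨r, hr0, hr⟩ := (halg.1 z).exists_nonzero_dvd (mem_nonZeroDivisors_of_ne_zero hz0)
    obtain ⟨w, hw⟩ := hr
    have h1 : ψ r = 0 := by
      rw [← hφψ, hw, map_mul]
      have : φ z = 0 := hz
      rw [this, zero_mul]
    exact hr0 (hψinj (by rw [h1, map_zero]))
  · intro z hz
    have h1 : IsIntegral (Algebra.adjoin ℤ (Set.range x)) (φ (y • z)) := (hy z hz).map φ
    have h2 := norm_le_one_of_isIntegral_padic p ψ (fun r => by rw [hψn]; exact hτ1 _) _ h1
    rw [Algebra.smul_def, map_mul, hφψ, norm_mul, hψn, hτy, one_mul] at h2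
    exact h2

/-- Skolem–Mahler–Lech for simple non-degenerate exponential sums in characteristic zero. -/
theorem sml_simple (K : Type*) [Field K] [CharZero K] {n : ℕ} (l c : Fin n → K)
    (hl : ∀ i, l i ≠ 0) (hd : ∀ N : ℕ, 0 < N → ∀ i j, l i ^ N = l j ^ N → i = j)
    (hz : {k : ℕ | ∑ i, c i * l i ^ k = 0}.Infinite) : c = 0 := by
  classical
  let T : Finset K := Finset.univ.image l ∪ Finset.univ.image (fun i => (l i)⁻¹)
    ∪ Finset.univ.image c
  let A : Subalgebra ℤ K := Algebra.adjoin ℤ (T : Set K)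
  have hft : Algebra.FiniteType ℤ A :=
    (Subalgebra.fg_iff_finiteType A).1 (Subalgebra.fg_adjoin_finset T)
  have hT : ∀ x ∈ T, x ∈ A := fun x hx => Algebra.subset_adjoin hx
  let lA : Fin n → A := fun i => ⟨l i, hT _ (by simp [T])⟩
  let mA : Fin n → A := fun i => ⟨(l i)⁻¹, hT _ (by simp [T])⟩
  let cA : Fin n → A := fun i => ⟨c i, hT _ (by simp [T])⟩
  have hlm : ∀ i, lA i * mA i = 1 := fun i => Subtype.ext (mul_inv_cancel₀ (hl i))
  obtain ⟨p, hp, φ, hφ, hφn⟩ := exists_padic_embedding A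
    (Finset.univ.image lA ∪ Finset.univ.image mA)
  have hln : ∀ i, ‖φ (lA i)‖ = 1 := by
    intro i
    have h1 := hφn (lA i) (by simp)
    have h2 := hφn (mA i) (by simp)
    refine le_antisymm h1 ?_
    have h3 : ‖φ (lA i)‖ * ‖φ (mA i)‖ = 1 := by
      rw [← norm_mul, ← map_mul, hlm, map_one, norm_one]
    calc (1 : ℝ) = ‖φ (lA i)‖ * ‖φ (mA i)‖ := h3.symm
      _ ≤ ‖φ (lA i)‖ := mul_le_of_le_one_right (norm_nonneg _) h2
  let U : Set (PadicAlgCl p) := Set.range (fun i => φ (lA i)) ∪ Set.range (fun i => φ (cA i))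
  let E : IntermediateField ℚ_[p] (PadicAlgCl p) := IntermediateField.adjoin ℚ_[p] U
  have hU : U.Finite := (Set.finite_range _).union (Set.finite_range _)
  have hfd : FiniteDimensional ℚ_[p] E := by
    have := hU.to_subtype
    exact IntermediateField.finiteDimensional_adjoin
      fun x _ => (Algebra.IsAlgebraic.isAlgebraic x).isIntegral
  let lE : Fin n → E := fun i => ⟨φ (lA i), IntermediateField.subset_adjoin _ _ (Or.inl ⟨i, rfl⟩)⟩
  let cE : Fin n → E := fun i => ⟨φ (cA i), IntermediateField.subset_adjoin _ _ (Or.inr ⟨i, rfl⟩)⟩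
  have hc : cE = 0 := by
    refine padic_sml p E lE cE (fun i => hln i) ?_ ?_
    · intro N hN i j hij
      refine hd N hN i j ?_
      have h1 : φ (lA i ^ N) = φ (lA j ^ N) := by
        rw [map_pow, map_pow]
        exact congrArg Subtype.val hij
      exact congrArg Subtype.val (hφ h1)
    · refine hz.mono fun k hk => ?_
      have h1 : ∑ i, cA i * lA i ^ k = 0 := by
        apply Subtype.ext
        push_cast
        exact hk
      have h2 : ∑ i, φ (cA i) * φ (lA i) ^ k = 0 := by
        rw [← map_zero φ, ← h1, map_sum]
        simp only [map_mul, map_pow]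
      apply Subtype.ext
      push_cast
      exact h2
  funext i
  have h1 : φ (cA i) = 0 := congrArg Subtype.val (congrFun hc i)
  exact congrArg Subtype.val (hφ (h1.trans (map_zero φ).symm))

theorem stmt_17 (K : Type*) [Field K] [CharZero K] (m : ℕ)
    (a : Fin m → Kˣ)
    -- `a₁, …, aₘ` are multiplicatively independent
    (hind : ∀ e : Fin m → ℤ, ∏ i, a i ^ e i = 1 → e = 0)
    (r₀ : Fin m → Kˣ)
    (f : MvPolynomial (Fin m) K)
    (hf : {k : ℕ |
      MvPolynomial.eval (fun i => ((r₀ i : K) * (a i : K) ^ k)) f = 0}.Infinite) :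
    f = 0 := by
  classical
  let e := f.support.equivFin.symm
  let u : (Fin m →₀ ℕ) → Kˣ := fun s => ∏ i, a i ^ s i
  let w : (Fin m →₀ ℕ) → Kˣ := fun s => ∏ i, r₀ i ^ s i
  have hmain := sml_simple K (fun j => ((u (e j).1 : Kˣ) : K))
    (fun j => f.coeff (e j).1 * ((w (e j).1 : Kˣ) : K)) (fun j => (u (e j).1).ne_zero) ?_ ?_
  · ext s
    rw [MvPolynomial.coeff_zero]
    by_contra hs
    have hs' : s ∈ f.support := MvPolynomial.mem_support_iff.2 hs
    have h1 := congrFun hmain (e.symm ⟨s, hs'⟩)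
    simp only [Equiv.apply_symm_apply, Pi.zero_apply] at h1
    exact mul_ne_zero hs (w s).ne_zero h1
  · intro N hN i j hij
    have h1 : u (e i).1 ^ N = u (e j).1 ^ N := Units.ext (by push_cast; exact hij)
    have h2 := hind (fun t => (N : ℤ) * ((((e i).1 t : ℕ) : ℤ) - (((e j).1 t : ℕ) : ℤ))) (by
      have h3 : ∏ t, a t ^ ((N : ℤ) * ((((e i).1 t : ℕ) : ℤ) - (((e j).1 t : ℕ) : ℤ)))
          = u (e i).1 ^ N / u (e j).1 ^ N := by
        simp only [u]
        rw [← Finset.prod_pow, ← Finset.prod_pow, ← Finset.prod_div_distrib]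
        refine Finset.prod_congr rfl fun t _ => ?_
        rw [mul_comm, zpow_mul, zpow_sub, zpow_natCast, zpow_natCast, zpow_natCast, mul_pow,
          inv_pow, div_eq_mul_inv]
      rw [h3, h1, div_self'])
    have h4 : (e i).1 = (e j).1 := by
      ext t
      have h5 := congrFun h2 t
      simp only [Pi.zero_apply, mul_eq_zero] at h5
      omega
    exact e.injective (Subtype.ext h4)
  · refine hf.mono fun k hk => ?_
    have hk' : MvPolynomial.eval (fun i => ((r₀ i : K) * (a i : K) ^ k)) f = 0 := hk
    rw [MvPolynomial.eval_eq', ← Finset.sum_coe_sort, ← e.sum_comp] at hk'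
    change ∑ j, _ = _
    rw [← hk']
    refine Finset.sum_congr rfl fun j _ => ?_
    simp only [u, w]
    push_cast
    rw [mul_assoc, ← Finset.prod_pow, ← Finset.prod_mul_distrib]
    congr 1
    refine Finset.prod_congr rfl fun t _ => ?_
    rw [mul_pow, ← pow_mul, ← pow_mul, mul_comm k]
end

section
/- Let p be a rational prime with p ≠ 2 and p ≠ 5, and let π(p) be the Pisano period of the Fibonacci sequence modulo p. If 5 is a quadratic residue modulo p, then π(p) divides p − 1; otherwise π(p) divides p² − 1. -/
/-- The Pisano period of the Fibonacci sequence modulo `m`. -/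
noncomputable def pisano (m : ℕ) : ℕ :=
  sInf {n : ℕ | 0 < n ∧ Nat.fib n ≡ 0 [MOD m] ∧ Nat.fib (n + 1) ≡ 1 [MOD m]}


theorem fib_shift (p d r : ℕ) (h0 : (Nat.fib d : ZMod p) = 0)
    (h1 : (Nat.fib (d + 1) : ZMod p) = 1) :
    (Nat.fib (d + r) : ZMod p) = Nat.fib r := by
  cases r with
  | zero => simp [h0]
  | succ r =>
    have := Nat.fib_add d r
    rw [← add_assoc, this]
    push_cast
    rw [h0, h1]; ring

theorem pisano_dvd_aux (p N : ℕ) (h0 : (Nat.fib N : ZMod p) = 0)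
    (h1 : (Nat.fib (N + 1) : ZMod p) = 1) : pisano p ∣ N := by
  induction N using Nat.strong_induction_on with
  | _ N ih =>
    rcases Nat.eq_zero_or_pos N with rfl | hN
    · exact dvd_zero _
    have hmem : N ∈ {n : ℕ | 0 < n ∧ Nat.fib n ≡ 0 [MOD p] ∧ Nat.fib (n + 1) ≡ 1 [MOD p]} := by
      refine ⟨hN, ?_, ?_⟩
      · rw [← ZMod.natCast_eq_natCast_iff]; simpa using h0
      · rw [← ZMod.natCast_eq_natCast_iff]; simpa using h1
    have hle : pisano p ≤ N := Nat.sInf_le hmem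
    have hd : pisano p ∈ {n : ℕ | 0 < n ∧ Nat.fib n ≡ 0 [MOD p] ∧ Nat.fib (n + 1) ≡ 1 [MOD p]} :=
      Nat.sInf_mem ⟨N, hmem⟩
    obtain ⟨hd0, hd1, hd2⟩ := hd
    rw [← ZMod.natCast_eq_natCast_iff] at hd1 hd2
    simp only [Nat.cast_zero, Nat.cast_one] at hd1 hd2
    obtain ⟨k, rfl⟩ := Nat.exists_eq_add_of_le hle
    rw [fib_shift p _ k hd1 hd2] at h0
    rw [add_assoc, fib_shift p _ (k + 1) hd1 hd2] at h1
    exact (Nat.dvd_add_right (dvd_refl _)).2 (ih k (by omega) h0 h1)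

theorem binet_aux {K : Type*} [Field K] (s a b : K) (ha : a ^ 2 = a + 1) (hb : b ^ 2 = b + 1)
    (hs : a - b = s) (n : ℕ) :
    (Nat.fib n : K) * s = a ^ n - b ^ n ∧ (Nat.fib (n + 1) : K) * s = a ^ (n + 1) - b ^ (n + 1) := by
  induction n with
  | zero => simp [hs]
  | succ n ih =>
    refine ⟨ih.2, ?_⟩
    rw [Nat.fib_add_two]
    push_cast
    rw [add_mul, ih.1, ih.2]
    linear_combination (-a ^ n) * ha + b ^ n * hb

theorem pisano_field (p : ℕ) (hp : p.Prime) (hp2 : p ≠ 2) (hp5 : p ≠ 5)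
    {K : Type*} [Field K] [Fintype K] [CharP K p] (h : IsSquare (5 : K)) :
    pisano p ∣ Fintype.card K - 1 := by
  haveI := Fact.mk hp
  obtain ⟨s, hs⟩ := h
  have h2 : (2 : K) ≠ 0 := by
    intro h
    have : ((2 : ℕ) : K) = 0 := by exact_mod_cast h
    rw [CharP.cast_eq_zero_iff K p] at this
    exact hp2 ((Nat.prime_dvd_prime_iff_eq hp Nat.prime_two).1 this)
  have h5 : (5 : K) ≠ 0 := by
    intro h
    have : ((5 : ℕ) : K) = 0 := by exact_mod_cast h
    rw [CharP.cast_eq_zero_iff K p] at this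
    exact hp5 ((Nat.prime_dvd_prime_iff_eq hp Nat.prime_five).1 this)
  have hs0 : s ≠ 0 := by rintro rfl; simp at hs; exact h5 hs
  obtain ⟨a, ha⟩ : ∃ a : K, 2 * a = 1 + s := ⟨(1 + s) / 2, by field_simp⟩
  have h4 : (4 : K) ≠ 0 := by
    have : (4 : K) = 2 * 2 := by norm_num
    rw [this]; exact mul_ne_zero h2 h2
  have haa : a ^ 2 = a + 1 := by
    apply mul_left_cancel₀ h4
    linear_combination (2 * a - 1 + s) * ha - hs
  have hbb : (1 - a) ^ 2 = (1 - a) + 1 := by linear_combination haa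
  have hab : a * (1 - a) = -1 := by linear_combination -haa
  have ha0 : a ≠ 0 := by rintro rfl; simp at hab
  have hb0 : 1 - a ≠ 0 := by intro h; simp [h] at hab
  have hB := binet_aux s a (1 - a) haa hbb (by linear_combination ha) (Fintype.card K - 1)
  rw [pow_succ, pow_succ, FiniteField.pow_card_sub_one_eq_one a ha0,
    FiniteField.pow_card_sub_one_eq_one _ hb0] at hB
  obtain ⟨e0, e1⟩ := hB
  have f0 : (Nat.fib (Fintype.card K - 1) : K) = 0 := by
    apply mul_right_cancel₀ hs0; rw [e0]; ring
  have f1 : (Nat.fib (Fintype.card K - 1 + 1) : K) = 1 := by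
    apply mul_right_cancel₀ hs0; rw [e1]; linear_combination ha
  apply pisano_dvd_aux
  · rw [ZMod.natCast_eq_zero_iff]; exact (CharP.cast_eq_zero_iff K p _).1 f0
  · apply (ZMod.castHom (dvd_refl p) K).injective
    rw [map_natCast, f1, map_one]

theorem stmt_19 (p : ℕ) (hp : p.Prime) (hp2 : p ≠ 2) (hp5 : p ≠ 5) :
    (IsSquare (5 : ZMod p) → pisano p ∣ p - 1) ∧
    (¬ IsSquare (5 : ZMod p) → pisano p ∣ p ^ 2 - 1) := by
  haveI := Fact.mk hp
  refine ⟨fun h => ?_, fun _ => ?_⟩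
  · have := pisano_field p hp hp2 hp5 h
    rwa [ZMod.card] at this
  · haveI : Fintype (GaloisField p 2) := Fintype.ofFinite _
    have hc : Fintype.card (GaloisField p 2) = p ^ 2 := by
      rw [← Nat.card_eq_fintype_card]; exact GaloisField.card p 2 (by norm_num)
    rw [← hc]
    apply pisano_field p hp hp2 hp5
    have h50 : (5 : ZMod p) ≠ 0 := by
      intro h
      have : ((5 : ℕ) : ZMod p) = 0 := by exact_mod_cast h
      rw [ZMod.natCast_eq_zero_iff] at this
      exact hp5 ((Nat.prime_dvd_prime_iff_eq hp Nat.prime_five).1 this)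
    have e5 : (5 : GaloisField p 2) = algebraMap (ZMod p) (GaloisField p 2) 5 := (map_ofNat _ 5).symm
    have hodd := hp.odd_of_ne_two hp2
    rw [FiniteField.isSquare_iff, hc, e5, ← map_pow]
    · have : p ^ 2 / 2 = (p - 1) * ((p + 1) / 2) := by
        obtain ⟨k, rfl⟩ := hodd
        have h1 : (2 * k + 1) ^ 2 = 2 * (2 * k * (k + 1)) + 1 := by ring
        have h2 : (2 * k + 1 + 1) / 2 = k + 1 := by omega
        rw [h1, h2, Nat.add_sub_cancel]; omega
      rw [this, pow_mul, ZMod.pow_card_sub_one_eq_one h50, one_pow, map_one]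
    · rw [ringChar.eq (GaloisField p 2) p]; exact hp2
    · rw [e5]; simpa only [ne_eq, map_eq_zero] using h50
end
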